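/- A commutative ring R is Gorenstein Von Neumann regular (every R-module is Gorenstein flat) if and only if every injective R-module is flat (i.e., R is an IF-ring). -/

import Mathlib

universe u

/-- An `R`-module `M` is **Gorenstein flat** if there exists an exact complex
`F : ⋯ → F₋₁ → F₀ → F₁ → ⋯` of flat `R`-modules with `M` isomorphic to the image
of `F₀ → F₁`, such that `I ⊗_R F` is exact for every injective `R`-module `I`. -/
def IsGorensteinFlat (R : Type u) [CommRing R] (M : Type u)
    [AddCommGroup M] [Module R M] : Prop :=
  ∃ (F : ℤ → ModuleCat.{u} R) (d : ∀ i : ℤ, F i →ₗ[R] F (i + 1)),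
    (∀ i, Module.Flat R (F i)) ∧
    (∀ i, LinearMap.range (d i) = LinearMap.ker (d (i + 1))) ∧
    Nonempty (M ≃ₗ[R] LinearMap.range (d 0)) ∧
    (∀ I : ModuleCat.{u} R, Module.Injective R I →
      ∀ i : ℤ, LinearMap.range (LinearMap.lTensor (R := R) (M := I) (d i)) =
        LinearMap.ker (LinearMap.lTensor (R := R) (M := I) (d (i + 1))))

/-- A relation in which every element has a successor and a predecessor admits a bi-infinite
chain through any given element. -/
lemma exists_int_chain {α : Type*} {r : α → α → Prop} (hs : ∀ a, ∃ b, r a b)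
    (hp : ∀ b, ∃ a, r a b) (a : α) (k : ℤ) :
    ∃ K : ℤ → α, K k = a ∧ ∀ i, r (K i) (K (i + 1)) := by
  choose s hs using hs
  choose p hp using hp
  let K : ℤ → α
    | .ofNat n => s^[n] a
    | .negSucc n => p^[n + 1] a
  have hK : ∀ i, r (K i) (K (i + 1)) := by
    rintro (n | _ | n)
    · change r (s^[n] a) (s^[n + 1] a)
      rw [Function.iterate_succ_apply']
      exact hs _
    · exact hp a
    · change r (p^[n + 1 + 1] a) (p^[n + 1] a)
      rw [Function.iterate_succ_apply' p (n + 1)]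
      exact hp _
  refine ⟨fun i => K (i - k), by simp only [sub_self]; rfl, fun i => ?_⟩
  beta_reduce
  rw [add_sub_right_comm]
  exact hK _

/-- `B` is the cokernel of an embedding of `A` into a flat module. -/
def IsFlatCosyzygy (R : Type u) [CommRing R] (A B : ModuleCat.{u} R) : Prop :=
  ∃ (F : ModuleCat.{u} R) (f : A →ₗ[R] F) (g : F →ₗ[R] B),
    Module.Flat R F ∧ Function.Injective f ∧ Function.Surjective g ∧
      LinearMap.range f = LinearMap.ker g

lemma exists_isFlatCosyzygy_left (R : Type u) [CommRing R] (B : ModuleCat.{u} R) :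
    ∃ A, IsFlatCosyzygy R A B := by
  let g : (B →₀ R) →ₗ[R] B := Finsupp.linearCombination R id
  exact ⟨.of R (LinearMap.ker g), .of R (B →₀ R), (LinearMap.ker g).subtype, g,
    inferInstanceAs (Module.Flat R (B →₀ R)), Subtype.val_injective,
    Finsupp.linearCombination_id_surjective R B, Submodule.range_subtype _⟩

lemma exists_isFlatCosyzygy_right {R : Type u} [CommRing R]
    (h : ∀ (I : Type u) [AddCommGroup I] [Module R I], Module.Injective R I → Module.Flat R I)
    (A : ModuleCat.{u} R) : ∃ B, IsFlatCosyzygy R A B := by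
  let J := CategoryTheory.Injective.under A
  let f : A →ₗ[R] J := (CategoryTheory.Injective.ι A).hom
  have hJ : Module.Injective R J :=
    Module.injective_module_of_injective_object R J
      (inj := CategoryTheory.Injective.injective_under A)
  exact ⟨.of R (J ⧸ LinearMap.range f), J, f, (LinearMap.range f).mkQ, h J hJ,
    (ModuleCat.mono_iff_injective _).1 inferInstance, Submodule.mkQ_surjective _,
    (Submodule.ker_mkQ _).symm⟩

/-- If all injective modules are flat, every module is Gorenstein flat. -/
lemma isGorensteinFlat_of_injective_flat {R : Type u} [CommRing R]
    (h : ∀ (I : Type u) [AddCommGroup I] [Module R I], Module.Injective R I → Module.Flat R I)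
    (M : Type u) [AddCommGroup M] [Module R M] : IsGorensteinFlat R M := by
  obtain ⟨K, hK, hr⟩ := exists_int_chain (exists_isFlatCosyzygy_right h)
    (exists_isFlatCosyzygy_left R) (.of R M) (0 + 1)
  choose F f g hF hf hg hfg using hr
  have hrange (i : ℤ) : LinearMap.range (f (i + 1) ∘ₗ g i) = LinearMap.range (f (i + 1)) :=
    LinearMap.range_comp_of_range_eq_top _ (LinearMap.range_eq_top.2 (hg i))
  have hex (i : ℤ) : LinearMap.range (f (i + 1) ∘ₗ g i) =
      LinearMap.ker (f (i + 1 + 1) ∘ₗ g (i + 1)) := by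
    rw [hrange, hfg, LinearMap.ker_comp_of_ker_eq_bot _ (LinearMap.ker_eq_bot.2 (hf _))]
  refine ⟨F, fun i => f (i + 1) ∘ₗ g i, hF, hex, ?_, fun I hI i => ?_⟩
  · exact ⟨(CategoryTheory.eqToIso hK.symm).toLinearEquiv ≪≫ₗ
      LinearEquiv.ofInjective (f (0 + 1)) (hf _) ≪≫ₗ LinearEquiv.ofEq _ _ (hrange 0).symm⟩
  · have := h I hI
    exact (Module.Flat.lTensor_exact I (LinearMap.exact_iff.2 (hex i).symm)).linearMap_ker_eq.symm

/-- An injective module which is Gorenstein flat is flat, being a direct summand of a flat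
module. -/
lemma IsGorensteinFlat.flat_of_injective {R : Type u} [CommRing R] {I : Type u}
    [AddCommGroup I] [Module R I] (hM : IsGorensteinFlat R I) (hI : Module.Injective R I) :
    Module.Flat R I := by
  obtain ⟨F, d, hF, -, ⟨e⟩, -⟩ := hM
  obtain ⟨r, hr⟩ := hI.out ((LinearMap.range (d 0)).subtype ∘ₗ e.toLinearMap)
    (Subtype.val_injective.comp e.injective) LinearMap.id
  have := hF (0 + 1)
  exact Module.Flat.of_retract _ r (LinearMap.ext hr)

/-- `R` is Gorenstein Von Neumann regular iff every injective `R`-module is flat,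
i.e. `R` is an IF-ring. -/
theorem gorensteinVonNeumannRegular_iff_ifRing (R : Type u) [CommRing R] :
    (∀ (M : Type u) [AddCommGroup M] [Module R M], IsGorensteinFlat R M) ↔
    (∀ (I : Type u) [AddCommGroup I] [Module R I],
      Module.Injective R I → Module.Flat R I) := by
  exact ⟨fun h I _ _ hI => (h I).flat_of_injective hI,
    fun h M _ _ => isGorensteinFlat_of_injective_flat h M⟩
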